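/- arXiv:2305.01356 — 10 statements merged into one kernel-verified Lean document; each statement's English description precedes it below -/
import Mathlib

section
/- The cube-based horobox C = R(x,z,w,h) has diameter diam C = 2·arsinh((1/2)·w·√(d−1)) when w ≥ √((2^h − 1)/(d−1)), and diam C = 2·arsinh((1/2)·√(((d−1)·w² + (2^h − 1)²)/2^h)) otherwise. -/
/-- Hyperbolic distance in the half-space model, for points given as
pairs `(x, z)` with `x : EuclideanSpace ℝ (Fin n)` and `z : ℝ` (assumed positive). -/
noncomputable def hdist {n : ℕ} (p q : EuclideanSpace ℝ (Fin n) × ℝ) : ℝ :=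
  2 * Real.arsinh ((1 / 2) * Real.sqrt ((‖p.1 - q.1‖ ^ 2 + (p.2 - q.2) ^ 2) / (p.2 * q.2)))

/-- The cube-based horobox `R(x,z,w,h)`: the closed Euclidean box with opposite
corners `(x, z)` and `(x + z·(w,…,w), z·2^h)`. -/
def horobox {n : ℕ} (x : EuclideanSpace ℝ (Fin n)) (z w h : ℝ) :
    Set (EuclideanSpace ℝ (Fin n) × ℝ) :=
  {p | (∀ i, x i ≤ p.1 i ∧ p.1 i ≤ x i + z * w) ∧ z ≤ p.2 ∧ p.2 ≤ z * (2 : ℝ) ^ h}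

/-- The hyperbolic diameter of a set: the supremum of pairwise distances. -/
noncomputable def hdiam {n : ℕ} (S : Set (EuclideanSpace ℝ (Fin n) × ℝ)) : ℝ :=
  sSup {r : ℝ | ∃ p ∈ S, ∃ q ∈ S, r = hdist p q}

/-- The two extreme cases of a quadratic inequality for heights in `[z, z(1 + S)]` imply
the general one. -/
theorem sq_add_sq_sub_le_of_le {z S A M a b : ℝ} (hz : 0 < z) (hS : 0 < S) (hA : 0 ≤ A)
    (h₁ : A ≤ M) (h₂ : A + S ^ 2 ≤ M * (1 + S)) (ha : z ≤ a) (hab : a ≤ b)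
    (hb : b ≤ z * (1 + S)) : z ^ 2 * A + (a - b) ^ 2 ≤ M * (a * b) := by
  have ha₀ : 0 < a := hz.trans_le ha
  have hbS : b - a ≤ a * S := by nlinarith
  have hchord : a * A + (b - a) * S ≤ M * b := by
    refine le_of_mul_le_mul_left ?_ hS
    nlinarith [mul_le_mul_of_nonneg_left h₁ (sub_nonneg.2 hbS),
      mul_le_mul_of_nonneg_left h₂ (sub_nonneg.2 hab)]
  have hza : z ^ 2 * A ≤ a ^ 2 * A := by gcongr
  nlinarith [mul_le_mul_of_nonneg_left hchord ha₀.le,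
    mul_le_mul_of_nonneg_left hbS (sub_nonneg.2 hab)]

theorem norm_sub_sq_le_of_mem_horobox {n : ℕ} {x : EuclideanSpace ℝ (Fin n)} {z w h : ℝ}
    {p q : EuclideanSpace ℝ (Fin n) × ℝ} (hp : p ∈ horobox x z w h)
    (hq : q ∈ horobox x z w h) : ‖p.1 - q.1‖ ^ 2 ≤ z ^ 2 * (n * w ^ 2) := by
  rw [EuclideanSpace.real_norm_sq_eq]
  calc ∑ i, (p.1 - q.1) i ^ 2 ≤ ∑ _i : Fin n, (z * w) ^ 2 := by
        refine Finset.sum_le_sum fun i _ => ?_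
        obtain ⟨hp₁, hp₂⟩ := hp.1 i
        obtain ⟨hq₁, hq₂⟩ := hq.1 i
        rw [PiLp.sub_apply]
        exact sq_le_sq' (by linarith) (by linarith)
    _ = z ^ 2 * (n * w ^ 2) := by
        rw [Finset.sum_const, Finset.card_univ, Fintype.card_fin, nsmul_eq_mul]
        ring

theorem hdist_le_of_mem_horobox {n : ℕ} {x : EuclideanSpace ℝ (Fin n)} {z w h M : ℝ}
    (hz : 0 < z) (hh : 0 < h) (h₁ : n * w ^ 2 ≤ M)
    (h₂ : n * w ^ 2 + ((2 : ℝ) ^ h - 1) ^ 2 ≤ M * (2 : ℝ) ^ h)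
    {p q : EuclideanSpace ℝ (Fin n) × ℝ} (hp : p ∈ horobox x z w h)
    (hq : q ∈ horobox x z w h) :
    hdist p q ≤ 2 * Real.arsinh ((1 / 2) * Real.sqrt M) := by
  have hN := norm_sub_sq_le_of_mem_horobox hp hq
  obtain ⟨-, hp₁, hp₂⟩ := hp
  obtain ⟨-, hq₁, hq₂⟩ := hq
  have hS : 0 < (2 : ℝ) ^ h - 1 := sub_pos.2 (Real.one_lt_rpow one_lt_two hh)
  have hA : 0 ≤ (n : ℝ) * w ^ 2 := by positivity
  have hH : 1 + ((2 : ℝ) ^ h - 1) = (2 : ℝ) ^ h := by ring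
  have key : z ^ 2 * (n * w ^ 2) + (p.2 - q.2) ^ 2 ≤ M * (p.2 * q.2) := by
    rcases le_total p.2 q.2 with hpq | hpq
    · exact sq_add_sq_sub_le_of_le hz hS hA h₁ (by rwa [hH]) hp₁ hpq (by rwa [hH])
    · rw [← neg_sub q.2, neg_sq, mul_comm p.2]
      exact sq_add_sq_sub_le_of_le hz hS hA h₁ (by rwa [hH]) hq₁ hpq (by rwa [hH])
  have hpq : 0 < p.2 * q.2 := mul_pos (hz.trans_le hp₁) (hz.trans_le hq₁)
  have hle : (‖p.1 - q.1‖ ^ 2 + (p.2 - q.2) ^ 2) / (p.2 * q.2) ≤ M := by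
    rw [div_le_iff₀ hpq]
    linarith
  unfold hdist
  have := Real.arsinh_le_arsinh.2
    (mul_le_mul_of_nonneg_left (Real.sqrt_le_sqrt hle) (by norm_num : (0 : ℝ) ≤ 1 / 2))
  linarith

/-- The distance between the lower corner of a horobox and the horizontally opposite corner
at height `z * t`. -/
theorem hdist_corner {n : ℕ} (x : EuclideanSpace ℝ (Fin n)) {z : ℝ} (w t : ℝ) (hz : 0 < z) :
    hdist (x, z) (x + WithLp.toLp 2 (fun _ => z * w), z * t) =
      2 * Real.arsinh ((1 / 2) * Real.sqrt ((n * w ^ 2 + (t - 1) ^ 2) / t)) := by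
  have hN : ‖x - (x + WithLp.toLp 2 (fun _ => z * w))‖ ^ 2 = z ^ 2 * (n * w ^ 2) := by
    rw [EuclideanSpace.real_norm_sq_eq]
    simp
    ring
  unfold hdist
  rw [hN, show z ^ 2 * (n * w ^ 2) + (z - z * t) ^ 2 = z ^ 2 * (n * w ^ 2 + (t - 1) ^ 2) by ring,
    show z * (z * t) = z ^ 2 * t by ring, mul_div_mul_left _ _ (by positivity)]

theorem hdiam_horobox_eq {n : ℕ} (x : EuclideanSpace ℝ (Fin n)) {z w h M t : ℝ}
    (hz : 0 < z) (hw : 0 < w) (hh : 0 < h) (h₁ : n * w ^ 2 ≤ M)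
    (h₂ : n * w ^ 2 + ((2 : ℝ) ^ h - 1) ^ 2 ≤ M * (2 : ℝ) ^ h)
    (ht₁ : 1 ≤ t) (ht₂ : t ≤ (2 : ℝ) ^ h) (hM : (n * w ^ 2 + (t - 1) ^ 2) / t = M) :
    hdiam (horobox x z w h) = 2 * Real.arsinh ((1 / 2) * Real.sqrt M) := by
  have hzw : 0 ≤ z * w := by positivity
  have hH : 1 ≤ (2 : ℝ) ^ h := ht₁.trans ht₂
  refine IsGreatest.csSup_eq ⟨⟨(x, z), ?_, (x + WithLp.toLp 2 (fun _ => z * w), z * t), ?_, ?_⟩, ?_⟩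
  · exact ⟨fun i => ⟨le_rfl, le_add_of_nonneg_right hzw⟩, le_rfl, le_mul_of_one_le_right hz.le hH⟩
  · exact ⟨fun i => ⟨le_add_of_nonneg_right hzw, le_rfl⟩, le_mul_of_one_le_right hz.le ht₁,
      mul_le_mul_of_nonneg_left ht₂ hz.le⟩
  · rw [hdist_corner x w t hz, hM]
  · rintro r ⟨p, hp, q, hq, rfl⟩
    exact hdist_le_of_mem_horobox hz hh h₁ h₂ hp hq

/-- The horobox `R(x,z,w,h)` has diameter `2·arsinh((w/2)·√(d−1))` if
`w ≥ √((2^h − 1)/(d−1))`, and `2·arsinh((1/2)·√(((d−1)w² + (2^h−1)²)/2^h))` otherwise. -/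
theorem stmt_3 (d : ℕ) (hd : 2 ≤ d)
    (x : EuclideanSpace ℝ (Fin (d - 1))) (z w h : ℝ)
    (hz : 0 < z) (hw : 0 < w) (hh : 0 < h) :
    (Real.sqrt (((2 : ℝ) ^ h - 1) / ((d : ℝ) - 1)) ≤ w →
      hdiam (horobox x z w h) =
        2 * Real.arsinh ((1 / 2) * w * Real.sqrt ((d : ℝ) - 1))) ∧
    (w < Real.sqrt (((2 : ℝ) ^ h - 1) / ((d : ℝ) - 1)) →
      hdiam (horobox x z w h) =
        2 * Real.arsinh ((1 / 2) *
          Real.sqrt ((((d : ℝ) - 1) * w ^ 2 + ((2 : ℝ) ^ h - 1) ^ 2) / (2 : ℝ) ^ h))) := by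
  have hn : ((d - 1 : ℕ) : ℝ) = (d : ℝ) - 1 := by
    rw [Nat.cast_sub (by omega), Nat.cast_one]
  have hd₀ : 0 < (d : ℝ) - 1 := by
    rw [← hn]
    exact_mod_cast (by omega : 0 < d - 1)
  have hS : 0 < (2 : ℝ) ^ h - 1 := sub_pos.2 (Real.one_lt_rpow one_lt_two hh)
  have hH : 0 < (2 : ℝ) ^ h := by positivity
  constructor
  · intro hle
    rw [Real.sqrt_le_left hw.le, div_le_iff₀ hd₀] at hle
    rw [hdiam_horobox_eq (M := ((d : ℝ) - 1) * w ^ 2) (t := 1) x hz hw hh (by rw [hn])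
        (by rw [hn]; nlinarith) le_rfl (by linarith) (by rw [hn]; simp),
      mul_comm _ (w ^ 2), Real.sqrt_mul (sq_nonneg w), Real.sqrt_sq hw.le, mul_assoc]
  · intro hlt
    rw [Real.lt_sqrt hw.le, lt_div_iff₀ hd₀] at hlt
    refine hdiam_horobox_eq (t := (2 : ℝ) ^ h) x hz hw hh ?_ ?_ (by linarith) le_rfl (by rw [hn])
    · rw [hn, le_div_iff₀ hH]
      nlinarith
    · rw [hn, div_mul_cancel₀ _ hH.ne']
end

section
/- For every integer ℓ ≥ 0, every x ∈ ℝ^{d−1} and every z > 0, the cube-based horobox R(x, z, 2^{2^ℓ − 1}/√(d−1), 2^ℓ) has diameter exactly 2·arsinh(2^{2^ℓ − 2}). -/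
/-- On the square `[1, 2A]²` the quantity `(A² + (t - s)²) / (t s)` is at most `A²`. -/
theorem sq_add_sub_sq_le_mul {A t s : ℝ} (ht : 1 ≤ t) (ht' : t ≤ 2 * A) (hs : 1 ≤ s)
    (hs' : s ≤ 2 * A) : A ^ 2 + (t - s) ^ 2 ≤ A ^ 2 * (t * s) := by
  have h₁ : 0 ≤ (t - 1) * (2 * A - t) := mul_nonneg (by linarith) (by linarith)
  have h₂ : 0 ≤ (s - 1) * (2 * A - s) := mul_nonneg (by linarith) (by linarith)
  have h₃ : 0 ≤ ((t - 1) + (s - 1)) * (A - 1) ^ 2 :=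
    mul_nonneg (by linarith) (sq_nonneg _)
  have h₄ : 0 ≤ (2 + A ^ 2) * ((t - 1) * (s - 1)) :=
    mul_nonneg (by positivity) (mul_nonneg (by linarith) (by linarith))
  linarith

/-- Two points of a cube of side `a` in `ℝⁿ` have squared distance at most `n a²`. -/
theorem norm_sub_sq_le_of_mem_cube {n : ℕ} {x p q : EuclideanSpace ℝ (Fin n)} {a : ℝ}
    (hp : ∀ i, x i ≤ p i ∧ p i ≤ x i + a) (hq : ∀ i, x i ≤ q i ∧ q i ≤ x i + a) :
    ‖p - q‖ ^ 2 ≤ n * a ^ 2 := by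
  rw [EuclideanSpace.real_norm_sq_eq]
  calc ∑ i, (p - q) i ^ 2 ≤ ∑ _i : Fin n, a ^ 2 := by
        refine Finset.sum_le_sum fun i _ => sq_le_sq' ?_ ?_ <;>
          · rw [PiLp.sub_apply]
            linarith [(hp i).1, (hp i).2, (hq i).1, (hq i).2]
    _ = n * a ^ 2 := by simp

/-- The diameter of the horobox of width `A / √n` and height `h`, where `2 ^ h = 2 * A`, is
attained by opposite corners of its bottom face. -/
theorem hdiam_horobox {n : ℕ} (hn : 0 < n) (x : EuclideanSpace ℝ (Fin n)) {z A h : ℝ}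
    (hz : 0 < z) (hA : 1 ≤ A) (hh : (2 : ℝ) ^ h = 2 * A) :
    hdiam (horobox x z (A / √n) h) = 2 * Real.arsinh (A / 2) := by
  have hn' : (0 : ℝ) < n := by exact_mod_cast hn
  have hside : (n : ℝ) * (z * (A / √n)) ^ 2 = z ^ 2 * A ^ 2 := by
    rw [mul_pow, div_pow, Real.sq_sqrt hn'.le]
    field_simp
  have hw : 0 ≤ z * (A / √n) := by positivity
  refine IsGreatest.csSup_eq ⟨?_, ?_⟩
  · have hz' : z ≤ z * (2 : ℝ) ^ h := by
      rw [hh]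
      exact le_mul_of_one_le_right hz.le (by linarith)
    refine ⟨(WithLp.toLp 2 fun i => x i + z * (A / √n), z), ⟨fun i => ⟨?_, le_rfl⟩, le_rfl, hz'⟩,
      (x, z), ⟨fun i => ⟨le_rfl, ?_⟩, le_rfl, hz'⟩, ?_⟩
    · exact le_add_of_nonneg_right hw
    · exact le_add_of_nonneg_right hw
    · have hnorm : ‖(WithLp.toLp 2 fun i => x i + z * (A / √n)) - x‖ ^ 2 = z ^ 2 * A ^ 2 := by
        rw [EuclideanSpace.real_norm_sq_eq, ← hside]
        simp
      have hquot : (z ^ 2 * A ^ 2 + (z - z) ^ 2) / (z * z) = A ^ 2 := by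
        field_simp
        ring
      simp only [hdist]
      rw [hnorm, hquot, Real.sqrt_sq (by linarith), one_div_mul_eq_div]
  · rintro _ ⟨⟨p, t⟩, ⟨hp, ht, ht'⟩, ⟨q, s⟩, ⟨hq, hs, hs'⟩, rfl⟩
    simp only [hh] at hp ht ht' hq hs hs'
    have hnorm := (norm_sub_sq_le_of_mem_cube hp hq).trans_eq hside
    have hmain := sq_add_sub_sq_le_mul (A := A) ((one_le_div hz).2 ht)
      ((div_le_iff₀' hz).2 ht') ((one_le_div hz).2 hs) ((div_le_iff₀' hz).2 hs')
    have hle : z ^ 2 * A ^ 2 + (t - s) ^ 2 ≤ A ^ 2 * (t * s) := by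
      have := mul_le_mul_of_nonneg_left hmain (sq_nonneg z)
      field_simp at this
      linarith
    have hts : 0 < t * s := mul_pos (hz.trans_le ht) (hz.trans_le hs)
    have hsqrt : √((‖p - q‖ ^ 2 + (t - s) ^ 2) / (t * s)) ≤ A := by
      refine Real.sqrt_le_iff.2 ⟨by linarith, (div_le_iff₀ hts).2 ?_⟩
      linarith
    simp only [hdist]
    have := Real.arsinh_le_arsinh.2
      (show 1 / 2 * √((‖p - q‖ ^ 2 + (t - s) ^ 2) / (t * s)) ≤ A / 2 by linarith)
    linarith

/-- For every integer `ℓ ≥ 0`, the cube-based horobox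
`R(x, z, 2^(2^ℓ − 1)/√(d−1), 2^ℓ)` has diameter `2·arsinh(2^(2^ℓ − 2))`. -/
theorem stmt_4 (d : ℕ) (hd : 2 ≤ d) (ℓ : ℤ) (hℓ : 0 ≤ ℓ)
    (x : EuclideanSpace ℝ (Fin (d - 1))) (z : ℝ) (hz : 0 < z) :
    hdiam (horobox x z ((2 : ℝ) ^ ((2 : ℝ) ^ (ℓ : ℝ) - 1) / Real.sqrt ((d : ℝ) - 1))
        ((2 : ℝ) ^ (ℓ : ℝ))) =
      2 * Real.arsinh ((2 : ℝ) ^ ((2 : ℝ) ^ (ℓ : ℝ) - 2)) := by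
  have hH : (1 : ℝ) ≤ (2 : ℝ) ^ (ℓ : ℝ) :=
    Real.one_le_rpow one_le_two (by exact_mod_cast hℓ)
  have hcast : (d : ℝ) - 1 = ((d - 1 : ℕ) : ℝ) := by
    rw [Nat.cast_sub (by omega), Nat.cast_one]
  have hhalf : (2 : ℝ) ^ ((2 : ℝ) ^ (ℓ : ℝ) - 2) = (2 : ℝ) ^ ((2 : ℝ) ^ (ℓ : ℝ) - 1) / 2 := by
    rw [← Real.rpow_sub_one two_ne_zero]
    ring_nf
  rw [hcast, hhalf]
  refine hdiam_horobox (by omega) x hz (Real.one_le_rpow one_le_two (sub_nonneg.2 hH)) ?_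
  rw [Real.rpow_sub_one two_ne_zero]
  ring
end

section
/- For every integer ℓ ≥ 4, the ratio arsinh(2^{2^{ℓ−1} − 2}) / arsinh(2^{2^ℓ − 2}) is strictly greater than 7/16 and strictly less than 8/15. (This is the ratio between the diameter 2·arsinh(2^{2^{ℓ−1}−2}) of a level-(ℓ−1) hyperbolic quadtree cell and the diameter 2·arsinh(2^{2^ℓ−2}) of its level-ℓ parent.) -/
lemma log_two_mul_lt_arsinh {x : ℝ} (hx : 0 < x) : Real.log (2 * x) < Real.arsinh x := by
  have h : x < √(1 + x ^ 2) := Real.lt_sqrt_of_sq_lt (by linarith)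
  exact Real.log_lt_log (by positivity) (by linarith)

lemma arsinh_lt_log_four_mul {x : ℝ} (hx : 1 ≤ x) : Real.arsinh x < Real.log (4 * x) := by
  have h : √(1 + x ^ 2) < 3 * x := (Real.sqrt_lt' (by positivity)).2 (by nlinarith)
  exact Real.log_lt_log (by positivity) (by linarith)

lemma sub_one_mul_log_two_lt_arsinh (t : ℝ) :
    (t - 1) * Real.log 2 < Real.arsinh ((2 : ℝ) ^ (t - 2)) := by
  have h := log_two_mul_lt_arsinh (x := (2 : ℝ) ^ (t - 2)) (by positivity)
  rw [Real.log_mul (by norm_num) (by positivity), Real.log_rpow (by norm_num)] at h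
  linarith

lemma arsinh_lt_mul_log_two {t : ℝ} (ht : 2 ≤ t) :
    Real.arsinh ((2 : ℝ) ^ (t - 2)) < t * Real.log 2 := by
  have h := arsinh_lt_log_four_mul (x := (2 : ℝ) ^ (t - 2))
    (Real.one_le_rpow (by norm_num) (by linarith))
  have h4 : Real.log 4 = 2 * Real.log 2 := by
    rw [show (4 : ℝ) = 2 ^ 2 by norm_num, Real.log_pow]
    norm_num
  rw [Real.log_mul (by norm_num) (by positivity), Real.log_rpow (by norm_num), h4] at h
  linarith


/-- For every integer `ℓ ≥ 4`, the ratio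
`arsinh(2^(2^(ℓ−1) − 2)) / arsinh(2^(2^ℓ − 2))` lies strictly between `7/16` and `8/15`. -/
theorem stmt_6 (ℓ : ℤ) (hℓ : 4 ≤ ℓ) :
    7 / 16 < Real.arsinh ((2 : ℝ) ^ ((2 : ℝ) ^ ((ℓ : ℝ) - 1) - 2)) /
        Real.arsinh ((2 : ℝ) ^ ((2 : ℝ) ^ (ℓ : ℝ) - 2)) ∧
      Real.arsinh ((2 : ℝ) ^ ((2 : ℝ) ^ ((ℓ : ℝ) - 1) - 2)) /
        Real.arsinh ((2 : ℝ) ^ ((2 : ℝ) ^ (ℓ : ℝ) - 2)) < 8 / 15 := by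
  have hlog : 0 < Real.log 2 := Real.log_pos (by norm_num)
  have hdouble : (2 : ℝ) ^ (ℓ : ℝ) = 2 * (2 : ℝ) ^ ((ℓ : ℝ) - 1) := by
    rw [Real.rpow_sub_one (by norm_num)]
    ring
  have hm : (8 : ℝ) ≤ (2 : ℝ) ^ ((ℓ : ℝ) - 1) := by
    have h4 : (4 : ℝ) ≤ ℓ := by exact_mod_cast hℓ
    calc (8 : ℝ) = (2 : ℝ) ^ (3 : ℝ) := by norm_num
      _ ≤ _ := Real.rpow_le_rpow_of_exponent_le (by norm_num) (by linarith)
  rw [hdouble]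
  generalize (2 : ℝ) ^ ((ℓ : ℝ) - 1) = m at hm ⊢
  have hchild := sub_one_mul_log_two_lt_arsinh m
  have hchild' := arsinh_lt_mul_log_two (t := m) (by linarith)
  have hparent := sub_one_mul_log_two_lt_arsinh (2 * m)
  have hparent' := arsinh_lt_mul_log_two (t := 2 * m) (by linarith)
  have hpos : 0 < Real.arsinh ((2 : ℝ) ^ (2 * m - 2)) := Real.arsinh_pos_iff.2 (by positivity)
  have hmlog : 8 * Real.log 2 ≤ m * Real.log 2 := mul_le_mul_of_nonneg_right hm hlog.le
  rw [lt_div_iff₀ hpos, div_lt_iff₀ hpos]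
  constructor <;> linarith
end

section
/- Define g(ℓ, α) = 2·arsinh((1/2)·√((α²·4^ℓ + (2^{2^ℓ} − 1)²)/2^{2^ℓ})) for an integer ℓ and a real α. Then for every integer ℓ ≤ −2, every real α with 1/2 < α ≤ 1, and every α' equal to α or to α·2^{−2^{ℓ−1}}, the ratio g(ℓ−1, α') / g(ℓ, α) is strictly greater than 0.46 and strictly less than 0.55. -/
/-- `g ℓ α = 2·arsinh((1/2)·√((α²·4^ℓ + (2^(2^ℓ) − 1)²)/2^(2^ℓ)))`, the diameter of a
level-`ℓ` hyperbolic quadtree cell (`ℓ < 0`) with cell-specific parameter `α`. -/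
noncomputable def g (ℓ : ℤ) (α : ℝ) : ℝ :=
  2 * Real.arsinh ((1 / 2) *
    Real.sqrt ((α ^ 2 * (4 : ℝ) ^ (ℓ : ℝ) + ((2 : ℝ) ^ ((2 : ℝ) ^ (ℓ : ℝ)) - 1) ^ 2) /
      (2 : ℝ) ^ ((2 : ℝ) ^ (ℓ : ℝ))))

namespace Real

theorem concaveOn_arsinh : ConcaveOn ℝ (Set.Ici 0) arsinh := by
  refine AntitoneOn.concaveOn_of_deriv (convex_Ici 0) continuous_arsinh.continuousOn
    differentiable_arsinh.differentiableOn ?_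
  intro x hx y _ hxy
  rw [interior_Ici, Set.mem_Ioi] at hx
  rw [(hasDerivAt_arsinh x).deriv, (hasDerivAt_arsinh y).deriv]
  gcongr

theorem mul_arsinh_le_arsinh_mul {c y : ℝ} (hc₀ : 0 ≤ c) (hc₁ : c ≤ 1) (hy : 0 ≤ y) :
    c * arsinh y ≤ arsinh (c * y) := by
  have := concaveOn_arsinh.2 (x := y) (y := 0) hy Set.self_mem_Ici hc₀ (sub_nonneg.2 hc₁)
    (by ring)
  simpa using this

theorem div_sqrt_le_arsinh {y : ℝ} (hy : 0 < y) : y / √(1 + y ^ 2) ≤ arsinh y := by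
  have := concaveOn_arsinh.le_slope_of_hasDerivAt (x := 0) (y := y) Set.self_mem_Ici hy.le hy
    (hasDerivAt_arsinh y)
  rw [slope_def_field, arsinh_zero, sub_zero, sub_zero, le_div_iff₀ hy] at this
  rwa [div_eq_inv_mul]

theorem arsinh_le_self {x : ℝ} (hx : 0 ≤ x) : arsinh x ≤ x := by
  simpa using self_le_sinh_iff.2 (arsinh_nonneg_iff.2 hx)

theorem sq_le_mul_arsinh_sq {y : ℝ} (hy : 0 < y) : y ^ 2 ≤ (1 + y ^ 2) * arsinh y ^ 2 := by
  have h := pow_le_pow_left₀ (by positivity) (div_sqrt_le_arsinh hy) 2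
  rw [div_pow, sq_sqrt (by positivity), div_le_iff₀ (by positivity)] at h
  linarith

end Real

theorem arsinh_ratio_bounds {A B : ℝ} (hA : 0 < A) (hA' : A ≤ 0.14) (hlow : 0.2116 * A < B)
    (hupp : B ≤ 0.285 * A) :
    0.46 < 2 * Real.arsinh ((1 / 2) * √B) / (2 * Real.arsinh ((1 / 2) * √A)) ∧
      2 * Real.arsinh ((1 / 2) * √B) / (2 * Real.arsinh ((1 / 2) * √A)) < 0.55 := by
  have hB : 0 < B := by linarith
  have hy : 0 < (1 / 2) * √A := by positivity
  have hx : 0 < (1 / 2) * √B := by positivity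
  have hy2 : ((1 / 2) * √A) ^ 2 = A / 4 := by rw [mul_pow, Real.sq_sqrt hA.le]; ring
  have hx2 : ((1 / 2) * √B) ^ 2 = B / 4 := by rw [mul_pow, Real.sq_sqrt hB.le]; ring
  generalize (1 / 2) * √A = y at *
  generalize (1 / 2) * √B = x at *
  have ha : 0 < Real.arsinh y := Real.arsinh_pos_iff.2 hy
  rw [mul_div_mul_left _ _ two_ne_zero, lt_div_iff₀ ha, div_lt_iff₀ ha]
  constructor
  · refine (Real.mul_arsinh_le_arsinh_mul (by norm_num) (by norm_num) hy.le).trans_lt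
      (Real.arsinh_lt_arsinh.2 ?_)
    refine lt_of_pow_lt_pow_left₀ 2 hx.le ?_
    rw [mul_pow, hx2, hy2]
    linarith
  · refine (Real.arsinh_le_self hx.le).trans_lt ?_
    refine lt_of_pow_lt_pow_left₀ 2 (by positivity) ?_
    have h := Real.sq_le_mul_arsinh_sq hy
    rw [hy2] at h
    rw [mul_pow, hx2]
    nlinarith [sq_pos_of_pos ha]

theorem cell_diameter_bounds {h z α β : ℝ} (hh : 0 < h) (hh' : h ≤ 1 / 8) (hz : 1 < z)
    (hzh : z ≤ 1 + h) (hα : 0 < α) (hα' : α ≤ 1) (hβ : α / z ≤ β) (hβ' : β ≤ α) :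
    0 < (α ^ 2 * (4 * h ^ 2) + (z ^ 2 - 1) ^ 2) / z ^ 2 ∧
    (α ^ 2 * (4 * h ^ 2) + (z ^ 2 - 1) ^ 2) / z ^ 2 ≤ 0.14 ∧
    0.2116 * ((α ^ 2 * (4 * h ^ 2) + (z ^ 2 - 1) ^ 2) / z ^ 2) <
      (β ^ 2 * h ^ 2 + (z - 1) ^ 2) / z ∧
    (β ^ 2 * h ^ 2 + (z - 1) ^ 2) / z ≤
      0.285 * ((α ^ 2 * (4 * h ^ 2) + (z ^ 2 - 1) ^ 2) / z ^ 2) := by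
  have hz0 : 0 < z := by linarith
  have hz8 : z ≤ 9 / 8 := by linarith
  have hβ0 : 0 < β := (div_pos hα hz0).trans_le hβ
  have hw : (z - 1) ^ 2 ≤ (1 / 8) ^ 2 := pow_le_pow_left₀ (by linarith) (by linarith) 2
  have hw0 : 0 < (z - 1) ^ 2 := pow_pos (by linarith) 2
  have hz1 : (z + 1) ^ 2 ≤ (17 / 8) ^ 2 := pow_le_pow_left₀ (by linarith) (by linarith) 2
  have hz1' : 2 ^ 2 ≤ (z + 1) ^ 2 := pow_le_pow_left₀ (by norm_num) (by linarith) 2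
  have hαh : α ^ 2 * h ^ 2 ≤ 1 * (1 / 8) ^ 2 := by
    gcongr
    exact pow_le_one₀ hα.le hα'
  have hβα : β ^ 2 * h ^ 2 ≤ α ^ 2 * h ^ 2 := by gcongr
  have hαβ : α ^ 2 * h ^ 2 ≤ z ^ 2 * (β ^ 2 * h ^ 2) := by
    rw [div_le_iff₀ hz0] at hβ
    calc α ^ 2 * h ^ 2 ≤ (β * z) ^ 2 * h ^ 2 := by gcongr
      _ = _ := by ring
  have hP : 0 < β ^ 2 * h ^ 2 := by positivity
  have hQ : 0 < α ^ 2 * h ^ 2 := by positivity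
  have hN : α ^ 2 * (4 * h ^ 2) + (z ^ 2 - 1) ^ 2 =
      4 * (α ^ 2 * h ^ 2) + (z + 1) ^ 2 * (z - 1) ^ 2 := by ring
  rw [hN]
  have hB : (β ^ 2 * h ^ 2 + (z - 1) ^ 2) / z = z * (β ^ 2 * h ^ 2 + (z - 1) ^ 2) / z ^ 2 := by
    field_simp
  rw [hB, ← mul_div_assoc, ← mul_div_assoc]
  generalize α ^ 2 * h ^ 2 = Q at *
  generalize β ^ 2 * h ^ 2 = P at *
  have hup : (z + 1) ^ 2 * (z - 1) ^ 2 ≤ (17 / 8) ^ 2 * (z - 1) ^ 2 := by gcongr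
  have hlo : 2 ^ 2 * (z - 1) ^ 2 ≤ (z + 1) ^ 2 * (z - 1) ^ 2 := by gcongr
  have hzw : 1 * (z - 1) ^ 2 ≤ z * (z - 1) ^ 2 := by gcongr
  have hzw' : z * (z - 1) ^ 2 ≤ 9 / 8 * (z - 1) ^ 2 := by gcongr
  have hzP : z * (z * P) ≤ 9 / 8 * (z * P) := by gcongr
  have hzP' : z * P ≤ 9 / 8 * P := by gcongr
  generalize (z - 1) ^ 2 = W at *
  have hz_sq : 1 ≤ z ^ 2 := one_le_pow₀ hz.le
  have hz2 : 0 < z ^ 2 := by positivity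
  refine ⟨by positivity, ?_, ?_, ?_⟩
  · rw [div_le_iff₀ hz2]
    linarith
  · exact div_lt_div_of_pos_right (by linarith) hz2
  · exact div_le_div_of_nonneg_right (by linarith) hz2.le

/-- For every integer `ℓ ≤ −2`, every `α ∈ (1/2, 1]` and every
`α' ∈ {α, α·2^(−2^(ℓ−1))}`, the ratio `g (ℓ−1) α' / g ℓ α` lies strictly
between `0.46` and `0.55`. -/
theorem stmt_7 (ℓ : ℤ) (hℓ : ℓ ≤ -2) (α : ℝ) (hα₁ : 1 / 2 < α) (hα₂ : α ≤ 1)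
    (α' : ℝ) (hα' : α' = α ∨ α' = α * (2 : ℝ) ^ (-(2 : ℝ) ^ ((ℓ : ℝ) - 1))) :
    0.46 < g (ℓ - 1) α' / g ℓ α ∧ g (ℓ - 1) α' / g ℓ α < 0.55 := by
  set h : ℝ := (2 : ℝ) ^ ((ℓ : ℝ) - 1) with hh
  have hh0 : 0 < h := by positivity
  have hh8 : h ≤ 1 / 8 := by
    have hℓ' : (ℓ : ℝ) ≤ -2 := by exact_mod_cast hℓ
    calc h ≤ (2 : ℝ) ^ (-3 : ℝ) := Real.rpow_le_rpow_of_exponent_le (by norm_num) (by linarith)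
      _ = 1 / 8 := by
        rw [Real.rpow_neg (by norm_num)]
        norm_num
  have h2 : (2 : ℝ) ^ (ℓ : ℝ) = 2 * h := by
    rw [hh, Real.rpow_sub_one two_ne_zero]
    ring
  have h4 (x : ℝ) : (4 : ℝ) ^ x = ((2 : ℝ) ^ x) ^ 2 := by
    rw [← Real.rpow_natCast, ← Real.rpow_mul (by norm_num), mul_comm, Real.rpow_mul (by norm_num)]
    norm_num
  set z : ℝ := (2 : ℝ) ^ h with hz
  have hz1 : 1 < z := Real.one_lt_rpow (by norm_num) hh0
  have hzh : z ≤ 1 + h := by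
    have := rpow_one_add_le_one_add_mul_self (s := 1) (by norm_num) hh0.le (by linarith)
    rwa [one_add_one_eq_two, mul_one] at this
  have hzz : (2 : ℝ) ^ (2 * h) = z ^ 2 := by
    rw [hz, ← Real.rpow_natCast, ← Real.rpow_mul (by norm_num), mul_comm]
    norm_num
  rw [Real.rpow_neg (by norm_num), ← hz, ← div_eq_mul_inv] at hα'
  have hα0 : 0 < α := by linarith
  have hdiv : α / z ≤ α := div_le_self hα0.le hz1.le
  have hα'_bounds : α / z ≤ α' ∧ α' ≤ α := by
    rcases hα' with rfl | rfl
    · exact ⟨hdiv, le_rfl⟩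
    · exact ⟨le_rfl, hdiv⟩
  obtain ⟨hA, hA', hlow, hupp⟩ :=
    cell_diameter_bounds hh0 hh8 hz1 hzh hα0 hα₂ hα'_bounds.1 hα'_bounds.2
  have hg : g ℓ α = 2 * Real.arsinh ((1 / 2) *
      √((α ^ 2 * (4 * h ^ 2) + (z ^ 2 - 1) ^ 2) / z ^ 2)) := by
    rw [g, h4, h2, hzz, mul_pow]
    norm_num
  have hg' : g (ℓ - 1) α' = 2 * Real.arsinh ((1 / 2) *
      √((α' ^ 2 * h ^ 2 + (z - 1) ^ 2) / z)) := by
    rw [g, h4, Int.cast_sub, Int.cast_one, ← hh, ← hz]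
  rw [hg, hg']
  exact arsinh_ratio_bounds hA hA' hlow hupp
end

section
/- For every x ∈ ℝ^{d−1} and z, w, h > 0, the cube-based horobox R(x,z,w,h) contains a closed hyperbolic ball of diameter min(h·ln 2, ln(1 + w)); that is, there exists a point c ∈ H^d such that the set {p ∈ H^d : d_H(p,c) ≤ (1/2)·min(h·ln 2, ln(1 + w))} is contained in R(x,z,w,h). -/
/-- A hyperbolic ball of radius `log s` centred at height `z * s` is, in Euclidean terms, a ball
whose vertical extent is `[z, z * s ^ 2]`. -/
lemma hdist_le_log_imp {n : ℕ} {p : EuclideanSpace ℝ (Fin n) × ℝ} {c : EuclideanSpace ℝ (Fin n)}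
    {z s : ℝ} (hp : 0 < p.2) (hz : 0 < z) (hs : 0 < s)
    (H : hdist p (c, z * s) ≤ Real.log s) :
    ‖p.1 - c‖ ^ 2 + (p.2 - z) * (p.2 - z * s ^ 2) ≤ 0 := by
  unfold hdist at H
  simp only at H
  set A := (‖p.1 - c‖ ^ 2 + (p.2 - z * s) ^ 2) / (p.2 * (z * s)) with hA
  have hden : 0 < p.2 * (z * s) := by positivity
  have hA0 : 0 ≤ A := by positivity
  have h1 : (1 / 2) * Real.sqrt A ≤ Real.sinh (Real.log s / 2) := by
    rw [← Real.arsinh_le_arsinh, Real.arsinh_sinh]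
    linarith
  have h2 : A ≤ 4 * Real.sinh (Real.log s / 2) ^ 2 := by
    have h3 := pow_le_pow_left₀ (by positivity) h1 2
    rw [mul_pow, Real.sq_sqrt hA0] at h3
    linarith
  have h3 : 4 * Real.sinh (Real.log s / 2) ^ 2 = s + s⁻¹ - 2 := by
    have h4 := Real.cosh_two_mul (Real.log s / 2)
    have h5 := Real.cosh_sq (Real.log s / 2)
    rw [mul_div_cancel₀ _ two_ne_zero, Real.cosh_log hs] at h4
    linarith
  rw [h3, hA, div_le_iff₀ hden] at h2
  have h4 : (s + s⁻¹ - 2) * (p.2 * (z * s)) = p.2 * z * (s ^ 2 + 1 - 2 * s) := by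
    field_simp
  rw [h4] at h2
  linarith

/-- Every cube-based horobox `R(x,z,w,h)` contains a closed hyperbolic ball of
diameter `min(h·ln 2, ln(1 + w))`. -/
theorem stmt_8 (d : ℕ) (hd : 2 ≤ d)
    (x : EuclideanSpace ℝ (Fin (d - 1))) (z w h : ℝ)
    (hz : 0 < z) (hw : 0 < w) (hh : 0 < h) :
    ∃ (cx : EuclideanSpace ℝ (Fin (d - 1))) (cz : ℝ), 0 < cz ∧
      {p : EuclideanSpace ℝ (Fin (d - 1)) × ℝ |
          0 < p.2 ∧ hdist p (cx, cz) ≤ (1 / 2) * min (h * Real.log 2) (Real.log (1 + w))}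
        ⊆ horobox x z w h := by
  set r := (1 / 2) * min (h * Real.log 2) (Real.log (1 + w)) with hr
  set s := Real.exp r with hs
  have hs0 : 0 < s := Real.exp_pos r
  have hsq : s ^ 2 = Real.exp (min (h * Real.log 2) (Real.log (1 + w))) := by
    rw [hs, ← Real.exp_nat_mul]
    congr 1
    push_cast
    linarith
  have hs_one : 1 ≤ s ^ 2 := by
    rw [hsq]
    exact Real.one_le_exp (le_min (by positivity) (Real.log_nonneg (by linarith)))
  have hs_pow : s ^ 2 ≤ (2 : ℝ) ^ h := by
    rw [hsq, Real.rpow_def_of_pos two_pos, mul_comm (Real.log 2)]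
    exact Real.exp_le_exp.2 (min_le_left _ _)
  have hs_width : s ^ 2 ≤ 1 + w := by
    rw [hsq, ← Real.le_log_iff_exp_le (by linarith)]
    exact min_le_right _ _
  refine ⟨WithLp.toLp 2 fun i => x i + z * w / 2, z * s, by positivity, ?_⟩
  rintro p ⟨hp, hpr⟩
  have hlog : r = Real.log s := (Real.log_exp r).symm
  rw [hlog] at hpr
  have key := hdist_le_log_imp hp hz hs0 hpr
  set c : EuclideanSpace ℝ (Fin (d - 1)) := WithLp.toLp 2 fun i => x i + z * w / 2 with hc
  have hzs : z ≤ z * s ^ 2 := le_mul_of_one_le_right hz.le hs_one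
  refine ⟨fun i => ?_, ?_, ?_⟩
  · have hnorm : ‖p.1 - c‖ ≤ z * w / 2 := by
      have hzw : z * s ^ 2 ≤ z * (1 + w) := mul_le_mul_of_nonneg_left hs_width hz.le
      have hrad : ‖p.1 - c‖ ≤ (z * s ^ 2 - z) / 2 := by
        refine (sq_le_sq₀ (norm_nonneg _) (by linarith)).1 ?_
        nlinarith [sq_nonneg (p.2 - (z + z * s ^ 2) / 2)]
      linarith
    have hi : |p.1 i - (x i + z * w / 2)| ≤ z * w / 2 :=
      (PiLp.norm_apply_le (p.1 - c) i).trans hnorm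
    rw [abs_le] at hi
    constructor <;> linarith
  · by_contra! hlt
    nlinarith [sq_nonneg ‖p.1 - c‖, mul_pos_of_neg_of_neg (sub_neg.2 hlt)
      (sub_neg.2 (hlt.trans_le hzs))]
  · refine le_trans ?_ (mul_le_mul_of_nonneg_left hs_pow hz.le)
    by_contra! hlt
    nlinarith [sq_nonneg ‖p.1 - c‖, mul_pos (sub_pos.2 hlt) (sub_pos.2 (hzs.trans_lt hlt))]
end

section
/- Let n > 1 be an odd positive integer and let X = {i/n : i = 0, 1, …, n−1} ⊆ ℝ. Then for every α = 2^{−ℓ} with ℓ ≥ 0 an integer, the set X mod α = {(i/n) mod α : i = 0, 1, …, n−1} is equal to the set α·X = {α·i/n : i = 0, 1, …, n−1}. -/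
/-- For real `x ≥ 0` and `y > 0`, `x mod y = x − y·⌊x/y⌋`. -/
noncomputable def rmod (x y : ℝ) : ℝ := x - y * ⌊x / y⌋

theorem rmod_natCast_div (n : ℕ) (hn : 0 < n) (ℓ i : ℕ) :
    rmod ((i : ℝ) / n) ((2 : ℝ) ^ (-(ℓ : ℤ))) =
      (2 : ℝ) ^ (-(ℓ : ℤ)) * (((i * 2 ^ ℓ % n : ℕ) : ℝ) / n) := by
  have hn' : (0 : ℝ) < n := by exact_mod_cast hn
  have hdiv : ((i * 2 ^ ℓ : ℕ) : ℝ) = n * (i * 2 ^ ℓ / n : ℕ) + (i * 2 ^ ℓ % n : ℕ) := by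
    exact_mod_cast (Nat.div_add_mod _ _).symm
  have hlt : ((i * 2 ^ ℓ % n : ℕ) : ℝ) < n := by exact_mod_cast Nat.mod_lt _ hn
  have hquot : (i : ℝ) / n / (2 : ℝ) ^ (-(ℓ : ℤ)) =
      ((i * 2 ^ ℓ / n : ℕ) : ℝ) + ((i * 2 ^ ℓ % n : ℕ) : ℝ) / n := by
    rw [zpow_neg, zpow_natCast, div_inv_eq_mul, div_mul_eq_mul_div, ← Nat.cast_ofNat,
      ← Nat.cast_pow, ← Nat.cast_mul, hdiv]
    field_simp
  have hfloor : ⌊(i : ℝ) / n / (2 : ℝ) ^ (-(ℓ : ℤ))⌋ = ((i * 2 ^ ℓ / n : ℕ) : ℤ) := by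
    rw [hquot, Int.floor_eq_iff, Int.cast_natCast]
    exact ⟨le_add_of_nonneg_right (by positivity),
      add_lt_add_right ((div_lt_one hn').2 hlt) _⟩
  have hα : (2 : ℝ) ^ (-(ℓ : ℤ)) ≠ 0 := by positivity
  rw [rmod, hfloor, Int.cast_natCast, eq_sub_iff_add_eq'.2 hquot.symm, mul_sub,
    mul_div_cancel₀ _ hα]

/-- For odd `n > 1`, `X = {i/n : 0 ≤ i < n}` and `α = 2^(−ℓ)` (`ℓ ≥ 0` an integer),
the set `X mod α` equals the set `α·X`. -/
theorem stmt_10 (n : ℕ) (hn : 1 < n) (hodd : Odd n) (ℓ : ℕ) :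
    {x : ℝ | ∃ i < n, x = rmod ((i : ℝ) / n) ((2 : ℝ) ^ (-(ℓ : ℤ)))} =
      {x : ℝ | ∃ i < n, x = (2 : ℝ) ^ (-(ℓ : ℤ)) * ((i : ℝ) / n)} := by
  have hpos : 0 < n := by omega
  simp only [rmod_natCast_div n hpos]
  ext x
  constructor
  · rintro ⟨i, -, rfl⟩
    exact ⟨_, Nat.mod_lt _ hpos, rfl⟩
  · rintro ⟨j, hj, rfl⟩
    obtain ⟨m, hm⟩ := Nat.exists_mul_mod_eq_one_of_coprime
      ((Nat.coprime_two_left.2 hodd).pow_left ℓ) hn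
    refine ⟨j * m % n, Nat.mod_lt _ hpos, ?_⟩
    have hmod : j * m % n * 2 ^ ℓ % n = j := by
      rw [Nat.mod_mul_mod, mul_assoc, mul_comm m, Nat.mul_mod, hm.2, mul_one, Nat.mod_mod,
        Nat.mod_eq_of_lt hj]
    rw [hmod]
end

section
/- For all real numbers p, q ∈ [0,1) with p ≠ q, there exist σ ∈ {0, 1/3, 2/3}, a nonnegative integer k, and an integer j with 0 ≤ j ≤ 2^k − 1, such that: both p + σ and q + σ lie in the interval [j·2^{1−k}, (j+1)·2^{1−k}); the length of this interval satisfies 2^{1−k} < 3·|p − q|; and min(p + σ, q + σ) < j·2^{1−k} + (1/3)·2^{1−k}. -/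
/-- Every `t` can be moved to a multiple of `3` by adding at most twice a unit modulo `3`. -/
theorem exists_three_dvd_add_mul (t N : ℤ) (hN : ¬ (3 : ℤ) ∣ N) :
    ∃ m j : ℤ, (m = 0 ∨ m = 1 ∨ m = 2) ∧ t + m * N = 3 * j := by
  have h : (3 : ℤ) ∣ t + 0 * N ∨ (3 : ℤ) ∣ t + 1 * N ∨ (3 : ℤ) ∣ t + 2 * N := by
    have ht : t % 3 = 0 ∨ t % 3 = 1 ∨ t % 3 = 2 := by omega
    have hN' : N % 3 = 1 ∨ N % 3 = 2 := by omega
    rcases ht with ht | ht | ht <;> rcases hN' with hN' | hN' <;> omega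
  rcases h with ⟨j, hj⟩ | ⟨j, hj⟩ | ⟨j, hj⟩
  · exact ⟨0, j, by simp, hj⟩
  · exact ⟨1, j, by simp, hj⟩
  · exact ⟨2, j, by simp, hj⟩

/-- For every dyadic cell length at most `1`, one of the shifts `0, 1/3, 2/3` moves `p` into the
lower third of a cell of that length. -/
theorem exists_shift_mem_lower_third (p : ℝ) (n : ℕ) :
    ∃ σ ∈ ({0, 1 / 3, 2 / 3} : Set ℝ), ∃ j : ℤ,
      (j : ℝ) ≤ (p + σ) * 2 ^ n ∧ (p + σ) * 2 ^ n < j + 1 / 3 := by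
  have hN : ¬ (3 : ℤ) ∣ 2 ^ n := fun h => by
    have := Int.prime_three.dvd_of_dvd_pow h
    omega
  obtain ⟨m, j, hm, hj⟩ := exists_three_dvd_add_mul ⌊3 * (p * 2 ^ n)⌋ (2 ^ n) hN
  have hj' : (⌊3 * (p * 2 ^ n)⌋ : ℝ) + m * 2 ^ n = 3 * j := by exact_mod_cast hj
  have h1 := Int.floor_le (3 * (p * 2 ^ n))
  have h2 := Int.lt_floor_add_one (3 * (p * 2 ^ n))
  refine ⟨(m : ℝ) / 3, ?_, j, by linarith, by linarith⟩
  rcases hm with rfl | rfl | rfl <;> simp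

/-- If `p < q` in `[0,1)`, a shift `σ ∈ {0, 1/3, 2/3}` puts both points in a common dyadic cell of
length less than `3 * (q - p)`, with `p + σ` in its lower third. -/
theorem exists_shift_cell_of_lt (p q : ℝ) (hp : 0 ≤ p) (hq : q < 1) (hpq : p < q) :
    ∃ σ ∈ ({0, 1 / 3, 2 / 3} : Set ℝ), ∃ (k : ℕ) (j : ℤ), 0 ≤ j ∧ j ≤ 2 ^ k - 1 ∧
      p + σ ∈ Set.Ico ((j : ℝ) * (2 : ℝ) ^ (1 - (k : ℤ))) (((j : ℝ) + 1) * (2 : ℝ) ^ (1 - (k : ℤ))) ∧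
      q + σ ∈ Set.Ico ((j : ℝ) * (2 : ℝ) ^ (1 - (k : ℤ))) (((j : ℝ) + 1) * (2 : ℝ) ^ (1 - (k : ℤ))) ∧
      (2 : ℝ) ^ (1 - (k : ℤ)) < 3 * (q - p) ∧
      p + σ < (j : ℝ) * (2 : ℝ) ^ (1 - (k : ℤ)) + (1 / 3) * (2 : ℝ) ^ (1 - (k : ℤ)) := by
  obtain ⟨n, hn1, hn2⟩ :=
    exists_mem_Ioc_zpow (show 0 < 3 * (q - p) by linarith) (one_lt_two (α := ℝ))
  have hn : n ≤ 1 := by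
    by_contra! h
    have : (2 : ℝ) ^ (2 : ℤ) ≤ 2 ^ n := zpow_le_zpow_right₀ one_le_two h
    norm_num at this
    linarith
  rw [zpow_add_one₀ two_ne_zero] at hn2
  obtain ⟨k, rfl⟩ : ∃ k : ℕ, n = 1 - (k : ℤ) := ⟨(1 - n).toNat, by omega⟩
  rcases k with _ | k
  · norm_num at hn1 hn2
    refine ⟨0, by simp, 0, 0, le_rfl, by norm_num, ?_, ?_, by norm_num; linarith,
      by norm_num; linarith⟩ <;> constructor <;> norm_num <;> linarith
  · obtain ⟨σ, hσ, j, hj1, hj2⟩ := exists_shift_mem_lower_third p k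
    have hσ' : 0 ≤ σ ∧ σ ≤ 2 / 3 := by
      rcases hσ with rfl | rfl | rfl <;> norm_num
    have hL : (2 : ℝ) ^ (1 - ((k + 1 : ℕ) : ℤ)) = (2 ^ k)⁻¹ := by
      rw [← zpow_natCast, ← zpow_neg]
      congr 1
      push_cast
      ring
    rw [hL] at hn1 hn2
    refine ⟨σ, hσ, k + 1, j, ?_⟩
    rw [hL]
    have hM : (0 : ℝ) < 2 ^ k := by positivity
    have hinv : (0 : ℝ) < (2 ^ k)⁻¹ := by positivity
    have hlow : (j : ℝ) * (2 ^ k)⁻¹ ≤ p + σ := by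
      rwa [← div_eq_mul_inv, div_le_iff₀ hM]
    have hup : p + σ < (j : ℝ) * (2 ^ k)⁻¹ + 1 / 3 * (2 ^ k)⁻¹ := by
      rwa [← add_mul, ← div_eq_mul_inv, lt_div_iff₀ hM]
    have hj0 : 0 ≤ j := by
      have : (0 : ℝ) ≤ (p + σ) * 2 ^ k := mul_nonneg (by linarith) hM.le
      have : ((-1 : ℤ) : ℝ) < j := by push_cast; linarith
      exact Int.lt_iff_add_one_le.mp (Int.cast_lt.mp this)
    have hjk : j < 2 ^ (k + 1) := by
      have : (p + σ) * 2 ^ k < 2 * 2 ^ k := mul_lt_mul_of_pos_right (by linarith) hM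
      have : (j : ℝ) < 2 ^ (k + 1) := by rw [pow_succ]; linarith
      exact_mod_cast this
    exact ⟨hj0, by omega, ⟨hlow, by linarith⟩, ⟨by linarith, by linarith⟩, hn1, hup⟩

/-- For distinct `p, q ∈ [0,1)` there is a shift `σ ∈ {0, 1/3, 2/3}` and a cell
`[j·2^(1−k), (j+1)·2^(1−k))` of the one-dimensional quadtree with largest cell `[0,2)`
that contains both `p + σ` and `q + σ`, has length less than `3·|p − q|`, and contains
one of the two shifted points in its lower third. -/
theorem stmt_11 (p q : ℝ) (hp : p ∈ Set.Ico (0 : ℝ) 1) (hq : q ∈ Set.Ico (0 : ℝ) 1)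
    (hpq : p ≠ q) :
    ∃ σ ∈ ({0, 1 / 3, 2 / 3} : Set ℝ), ∃ (k : ℕ) (j : ℤ), 0 ≤ j ∧ j ≤ 2 ^ k - 1 ∧
      p + σ ∈ Set.Ico ((j : ℝ) * (2 : ℝ) ^ (1 - (k : ℤ))) (((j : ℝ) + 1) * (2 : ℝ) ^ (1 - (k : ℤ))) ∧
      q + σ ∈ Set.Ico ((j : ℝ) * (2 : ℝ) ^ (1 - (k : ℤ))) (((j : ℝ) + 1) * (2 : ℝ) ^ (1 - (k : ℤ))) ∧
      (2 : ℝ) ^ (1 - (k : ℤ)) < 3 * |p - q| ∧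
      min (p + σ) (q + σ) <
        (j : ℝ) * (2 : ℝ) ^ (1 - (k : ℤ)) + (1 / 3) * (2 : ℝ) ^ (1 - (k : ℤ)) := by
  rcases lt_or_gt_of_ne hpq with h | h
  · obtain ⟨σ, hσ, k, j, h0, h1, h2, h3, h4, h5⟩ := exists_shift_cell_of_lt p q hp.1 hq.2 h
    refine ⟨σ, hσ, k, j, h0, h1, h2, h3, ?_, (min_le_left _ _).trans_lt h5⟩
    rwa [abs_sub_comm, abs_of_pos (sub_pos.mpr h)]
  · obtain ⟨σ, hσ, k, j, h0, h1, h2, h3, h4, h5⟩ := exists_shift_cell_of_lt q p hq.1 hp.2 h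
    refine ⟨σ, hσ, k, j, h0, h1, h3, h2, ?_, (min_le_right _ _).trans_lt h5⟩
    rwa [abs_of_pos (sub_pos.mpr h)]
end

section
/- Let d be a positive even integer and for j ∈ {0, 1, …, d} set v^{(j)} = (j/(d+1), …, j/(d+1)) ∈ ℝ^d. Then for every point p ∈ ℝ^d and every r = 2^{−ℓ} with ℓ ≥ 0 an integer, there exists j ∈ {0, 1, …, d} such that p + v^{(j)} is (1/(2d+2))-central in its grid hypercube of side length r; that is, for every coordinate i ∈ {1, …, d}, writing y_i = p_i + j/(d+1) and m_i = y_i − r·⌊y_i/r⌋, one has min(m_i, r − m_i) ≥ r/(2d+2). -/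
/-- If `x` is closer than `ε` to a wall of the grid of side length `r`, then it is at distance
less than `ε` from some multiple of `r`. -/
lemma exists_abs_sub_mul_lt_of_min_rmod_lt {x r ε : ℝ} (hr : 0 < r)
    (h : min (rmod x r) (r - rmod x r) < ε) : ∃ k : ℤ, |x - r * k| < ε := by
  have h0 : r * ⌊x / r⌋ ≤ x := by
    have := mul_le_mul_of_nonneg_left (Int.floor_le (x / r)) hr.le
    rwa [mul_div_cancel₀ _ hr.ne'] at this
  have h1 : x < r * (⌊x / r⌋ + 1) := by
    have := mul_lt_mul_of_pos_left (Int.lt_floor_add_one (x / r)) hr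
    rwa [mul_div_cancel₀ _ hr.ne'] at this
  unfold rmod at h
  rcases min_lt_iff.mp h with h | h
  · exact ⟨⌊x / r⌋, by rw [abs_of_nonneg (by linarith)]; exact h⟩
  · refine ⟨⌊x / r⌋ + 1, ?_⟩
    push_cast
    rw [abs_of_neg (by linarith)]
    linarith

/-- For `n` odd, two translates of `x` by `a / n` and `b / n` with `a, b < n` that are both closer
than `2⁻ˡ / (2 * n)` to multiples of `2⁻ˡ` coincide. -/
lemma eq_of_abs_add_div_sub_lt {n : ℕ} (hn : Odd n) (l : ℕ) {x : ℝ} {a b : ℕ}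
    (ha : a < n) (hb : b < n) {k m : ℤ}
    (h₁ : |x + a / n - (2 : ℝ) ^ (-(l : ℤ)) * k| < (2 : ℝ) ^ (-(l : ℤ)) / (2 * n))
    (h₂ : |x + b / n - (2 : ℝ) ^ (-(l : ℤ)) * m| < (2 : ℝ) ^ (-(l : ℤ)) / (2 * n)) :
    a = b := by
  have hn0 : (0 : ℝ) < n := by exact_mod_cast hn.pos
  have hR : (0 : ℝ) < 2 ^ l := by positivity
  rw [zpow_neg, zpow_natCast] at h₁ h₂
  have hlt : |((a : ℝ) - b) / n - (2 ^ l)⁻¹ * (k - m)| < (2 ^ l)⁻¹ / n := by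
    have e : (2 ^ l : ℝ)⁻¹ / n = (2 ^ l)⁻¹ / (2 * n) + (2 ^ l)⁻¹ / (2 * n) := by
      field_simp
      norm_num
    rw [e]
    rw [abs_lt] at h₁ h₂ ⊢
    rw [sub_div]
    constructor <;> linarith [h₁.1, h₁.2, h₂.1, h₂.2]
  have hreal : |((a : ℝ) - b) * 2 ^ l - n * (k - m)| < 1 := by
    have e : ((a : ℝ) - b) * 2 ^ l - n * (k - m) =
        (((a : ℝ) - b) / n - (2 ^ l)⁻¹ * (k - m)) * (2 ^ l * n) := by
      field_simp
    rw [e, abs_mul, abs_of_pos (mul_pos hR hn0)]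
    calc _ < (2 ^ l : ℝ)⁻¹ / n * (2 ^ l * n) :=
          mul_lt_mul_of_pos_right hlt (mul_pos hR hn0)
      _ = 1 := by field_simp
  have hint : ((a : ℤ) - b) * 2 ^ l - n * (k - m) = 0 :=
    Int.abs_lt_one_iff.mp (by exact_mod_cast hreal)
  have hdvd : (n : ℤ) ∣ (a - b) * 2 ^ l := ⟨k - m, by linarith⟩
  have hcop : IsCoprime (n : ℤ) (2 ^ l) := by
    have := Nat.isCoprime_iff_coprime.mpr (hn.coprime_two_right.pow_right l)
    exact_mod_cast this
  have hzero : (a : ℤ) - b = 0 :=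
    Int.eq_zero_of_abs_lt_dvd (hcop.dvd_of_dvd_mul_right hdvd) (by rw [abs_lt]; omega)
  omega

/-- (Chan) Let `d` be a positive even integer and `v⁽ʲ⁾ = (j/(d+1), …, j/(d+1))`.
For every `p ∈ ℝ^d` and every `r = 2^(−ℓ)` (`ℓ ≥ 0` an integer), there is a
`j ∈ {0, …, d}` such that `p + v⁽ʲ⁾` is `(1/(2d+2))`-central in its grid hypercube of
side length `r`: in every coordinate, with `m_i = (p_i + j/(d+1)) mod r`, we have
`min(m_i, r − m_i) ≥ r/(2d+2)`. -/
theorem stmt_12 (d : ℕ) (hd : 0 < d) (heven : Even d) (p : Fin d → ℝ) (ℓ : ℕ) :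
    ∃ j ≤ d, ∀ i : Fin d,
      min (rmod (p i + (j : ℝ) / ((d : ℝ) + 1)) ((2 : ℝ) ^ (-(ℓ : ℤ))))
          ((2 : ℝ) ^ (-(ℓ : ℤ)) - rmod (p i + (j : ℝ) / ((d : ℝ) + 1)) ((2 : ℝ) ^ (-(ℓ : ℤ)))) ≥
        (2 : ℝ) ^ (-(ℓ : ℤ)) / (2 * (d : ℝ) + 2) := by
  by_contra! hcon
  have hbad : ∀ j : Fin (d + 1), ∃ i : Fin d, ∃ k : ℤ,
      |p i + (j : ℕ) / ((d + 1 : ℕ) : ℝ) - (2 : ℝ) ^ (-(ℓ : ℤ)) * k| <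
        (2 : ℝ) ^ (-(ℓ : ℤ)) / (2 * ((d + 1 : ℕ) : ℝ)) := by
    intro j
    obtain ⟨i, hi⟩ := hcon j (Nat.lt_succ_iff.mp j.isLt)
    refine ⟨i, exists_abs_sub_mul_lt_of_min_rmod_lt (by positivity) ?_⟩
    push_cast
    rwa [mul_add, mul_one]
  choose f k hf using hbad
  obtain ⟨a, b, hab, hfab⟩ := Fintype.exists_ne_map_eq_of_card_lt f (by simp)
  have hb := hf b
  rw [← hfab] at hb
  exact hab (Fin.ext (eq_of_abs_add_div_sub_lt heven.add_one ℓ a.isLt b.isLt (hf a) hb))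
end

section
/- There is a universal constant c > 0 such that for every integer d ≥ 2 and every integer ℓ ≥ 0, one has 2·arsinh(2^{2^ℓ − 2}) ≤ c·d·√d·arsinh( 2^{2^{ℓ+1}/3} / (4(d+1)·√(d−1)) ). -/
theorem Real.convexOn_sinh : ConvexOn ℝ (Set.Ici 0) Real.sinh := by
  refine MonotoneOn.convexOn_of_deriv (convex_Ici 0) Real.continuous_sinh.continuousOn
    Real.differentiable_sinh.differentiableOn ?_
  intro x hx y hy hxy
  rw [interior_Ici, Set.mem_Ioi] at hx hy
  rw [Real.deriv_sinh, Real.cosh_le_cosh, abs_of_pos hx, abs_of_pos hy]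
  exact hxy

theorem Real.arsinh_le_mul_arsinh_div {x k : ℝ} (hx : 0 ≤ x) (hk : 1 ≤ k) :
    Real.arsinh x ≤ k * Real.arsinh (x / k) := by
  have hk0 : 0 < k := by linarith
  have hu : 0 ≤ Real.arsinh x := Real.arsinh_nonneg_iff.2 hx
  have hkinv : k⁻¹ ≤ 1 := inv_le_one_of_one_le₀ hk
  have h := Real.convexOn_sinh.2 (Set.mem_Ici.2 hu) (Set.mem_Ici.2 le_rfl)
    (inv_nonneg.2 hk0.le) (sub_nonneg.2 hkinv) (add_sub_cancel _ _)
  simp only [smul_eq_mul, mul_zero, add_zero, Real.sinh_zero, Real.sinh_arsinh] at h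
  have h2 := Real.arsinh_le_arsinh.2 h
  rw [Real.arsinh_sinh, inv_mul_eq_div, inv_mul_eq_div, div_le_iff₀ hk0] at h2
  linarith

theorem Real.log_le_arsinh {x : ℝ} (hx : 0 < x) : Real.log x ≤ Real.arsinh x :=
  Real.log_le_log hx (le_add_of_nonneg_right (Real.sqrt_nonneg _))

theorem Real.arsinh_le_log_one_add_two_mul {x : ℝ} (hx : 0 ≤ x) :
    Real.arsinh x ≤ Real.log (1 + 2 * x) := by
  have h : √(1 + x ^ 2) ≤ 1 + x := Real.sqrt_le_iff.2 ⟨by linarith, by nlinarith⟩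
  exact Real.log_le_log (by positivity) (by linarith)

/-- There is a universal constant `c > 0` such that for every `d ≥ 2` and integer
`ℓ ≥ 0`, `2·arsinh(2^(2^ℓ − 2)) ≤ c·d·√d·arsinh(2^(2^(ℓ+1)/3) / (4(d+1)·√(d−1)))`. -/
theorem stmt_14 :
    ∃ c : ℝ, 0 < c ∧
      ∀ d : ℕ, 2 ≤ d → ∀ ℓ : ℤ, 0 ≤ ℓ →
        2 * Real.arsinh ((2 : ℝ) ^ ((2 : ℝ) ^ (ℓ : ℝ) - 2)) ≤
          c * d * Real.sqrt d *
            Real.arsinh ((2 : ℝ) ^ ((2 : ℝ) ^ ((ℓ : ℝ) + 1) / 3) /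
              (4 * ((d : ℝ) + 1) * Real.sqrt ((d : ℝ) - 1))) := by
  refine ⟨18, by norm_num, fun d hd ℓ hℓ => ?_⟩
  have hd' : (2 : ℝ) ≤ d := by exact_mod_cast hd
  have ht : (1 : ℝ) ≤ 2 ^ (ℓ : ℝ) :=
    Real.one_le_rpow (by norm_num) (by exact_mod_cast hℓ)
  rw [Real.rpow_add_one (by norm_num : (2 : ℝ) ≠ 0)]
  generalize (2 : ℝ) ^ (ℓ : ℝ) = t at ht ⊢
  have hlhs : Real.arsinh (2 ^ (t - 2)) ≤ t * Real.log 2 := by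
    refine (Real.arsinh_le_log_one_add_two_mul (by positivity)).trans ?_
    rw [← Real.log_rpow (by norm_num : (0 : ℝ) < 2)]
    refine Real.log_le_log (by positivity) ?_
    have h1 : (2 : ℝ) ≤ 2 ^ t := by
      simpa using Real.rpow_le_rpow_of_exponent_le (by norm_num : (1 : ℝ) ≤ 2) ht
    rw [Real.rpow_sub (by norm_num : (0 : ℝ) < 2), Real.rpow_two]
    linarith
  have hs1 : 1 ≤ √((d : ℝ) - 1) := Real.one_le_sqrt.2 (by linarith)
  have hs2 : √((d : ℝ) - 1) ≤ √(d : ℝ) := Real.sqrt_le_sqrt (by linarith)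
  set K : ℝ := 4 * ((d : ℝ) + 1) * √((d : ℝ) - 1) with hK
  have hK1 : 1 ≤ K := by nlinarith
  have hKd : K ≤ 6 * d * √(d : ℝ) := by
    refine mul_le_mul (by linarith) hs2 (by linarith) (by linarith)
  have hA : (0 : ℝ) < 2 ^ (t * 2 / 3) := by positivity
  have hlog := Real.log_le_arsinh hA
  rw [Real.log_rpow (by norm_num : (0 : ℝ) < 2)] at hlog
  have hscale := Real.arsinh_le_mul_arsinh_div hA.le hK1
  have hnonneg : 0 ≤ Real.arsinh (2 ^ (t * 2 / 3) / K) :=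
    Real.arsinh_nonneg_iff.2 (by positivity)
  have hmul := mul_le_mul_of_nonneg_right hKd hnonneg
  linarith
end

section
/- There is a universal constant c > 0 such that for every integer d ≥ 2 and every integer ℓ < 0, one has 2·arsinh( (1/2)·√((4^ℓ + (2^{2^ℓ} − 1)²)/2^{2^ℓ}) ) ≤ c·d·√d·arsinh( 2^{ℓ−1} / ((2d+2)·2^{1/3}·√(d−1)) ). -/
theorem arsinh_le_self {x : ℝ} (hx : 0 ≤ x) : Real.arsinh x ≤ x := by
  rw [← Real.sinh_le_sinh, Real.sinh_arsinh]
  exact Real.self_le_sinh_iff.2 hx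

theorem half_le_arsinh {y : ℝ} (h0 : 0 ≤ y) (h1 : y ≤ 1) : y / 2 ≤ Real.arsinh y := by
  have hsqrt : 1 ≤ √(1 + y ^ 2) := Real.one_le_sqrt.2 (by nlinarith [sq_nonneg y])
  have hinv : (1 + y)⁻¹ ≤ 1 - y / 2 := by
    rw [inv_le_iff_one_le_mul₀ (by linarith)]
    nlinarith
  calc y / 2 ≤ 1 - (1 + y)⁻¹ := by linarith
    _ ≤ Real.log (1 + y) := Real.one_sub_inv_le_log_of_pos (by linarith)
    _ ≤ Real.arsinh y := Real.log_le_log (by linarith) (by linarith)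

/-- An upper bound for the argument of the left-hand `arsinh`, with `t` the side length. -/
theorem half_sqrt_cell_le {t : ℝ} (h0 : 0 ≤ t) (h1 : t ≤ 1) :
    1 / 2 * √((t ^ 2 + ((2 : ℝ) ^ t - 1) ^ 2) / (2 : ℝ) ^ t) ≤ t := by
  have hone : (1 : ℝ) ≤ 2 ^ t := Real.one_le_rpow one_le_two h0
  have hbern : (2 : ℝ) ^ t ≤ 1 + t := by
    have h := rpow_one_add_le_one_add_mul_self (s := 1) (by norm_num) h0 h1
    norm_num at h
    exact h
  have hsqrt : √((t ^ 2 + ((2 : ℝ) ^ t - 1) ^ 2) / (2 : ℝ) ^ t) ≤ 2 * t := by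
    refine Real.sqrt_le_iff.2 ⟨by linarith, ?_⟩
    refine (div_le_self (by positivity) hone).trans ?_
    nlinarith
  linarith

/-- There is a universal constant `c > 0` such that for every `d ≥ 2` and integer
`ℓ < 0`, `2·arsinh((1/2)·√((4^ℓ + (2^(2^ℓ) − 1)²)/2^(2^ℓ)))
  ≤ c·d·√d·arsinh(2^(ℓ−1) / ((2d+2)·2^(1/3)·√(d−1)))`. -/
theorem stmt_15 :
    ∃ c : ℝ, 0 < c ∧
      ∀ d : ℕ, 2 ≤ d → ∀ ℓ : ℤ, ℓ < 0 →
        2 * Real.arsinh ((1 / 2) *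
            Real.sqrt (((4 : ℝ) ^ (ℓ : ℝ) + ((2 : ℝ) ^ ((2 : ℝ) ^ (ℓ : ℝ)) - 1) ^ 2) /
              (2 : ℝ) ^ ((2 : ℝ) ^ (ℓ : ℝ)))) ≤
          c * d * Real.sqrt d *
            Real.arsinh ((2 : ℝ) ^ ((ℓ : ℝ) - 1) /
              ((2 * (d : ℝ) + 2) * (2 : ℝ) ^ ((1 : ℝ) / 3) * Real.sqrt ((d : ℝ) - 1))) := by
  refine ⟨48, by norm_num, fun d hd ℓ hℓ => ?_⟩
  have hd' : (2 : ℝ) ≤ d := by exact_mod_cast hd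
  have hfour : (4 : ℝ) ^ (ℓ : ℝ) = ((2 : ℝ) ^ (ℓ : ℝ)) ^ 2 := by
    rw [show (4 : ℝ) = 2 * 2 by norm_num, Real.mul_rpow (by norm_num) (by norm_num), sq]
  have hhalf : (2 : ℝ) ^ ((ℓ : ℝ) - 1) = (2 : ℝ) ^ (ℓ : ℝ) / 2 := by
    rw [Real.rpow_sub_one two_ne_zero]
  have ht0 : 0 < (2 : ℝ) ^ (ℓ : ℝ) := by positivity
  have ht1 : (2 : ℝ) ^ (ℓ : ℝ) ≤ 1 :=
    Real.rpow_le_one_of_one_le_of_nonpos one_le_two (by exact_mod_cast hℓ.le)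
  rw [hfour, hhalf]
  generalize (2 : ℝ) ^ (ℓ : ℝ) = t at ht0 ht1 ⊢
  have hlhs := (Real.arsinh_le_arsinh.2 (half_sqrt_cell_le ht0.le ht1)).trans
    (arsinh_le_self ht0.le)
  have hs : 1 ≤ √(d : ℝ) := Real.one_le_sqrt.2 (by linarith)
  have hs' : 0 < √((d : ℝ) - 1) := Real.sqrt_pos.2 (by linarith)
  have hcbrt : (2 : ℝ) ^ ((1 : ℝ) / 3) ≤ 2 :=
    Real.rpow_le_self_of_one_le one_le_two (by norm_num)
  have hden : (2 * (d : ℝ) + 2) * (2 : ℝ) ^ ((1 : ℝ) / 3) * √((d : ℝ) - 1) ≤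
      (3 * d) * 2 * √(d : ℝ) := by
    gcongr <;> linarith
  have hz : t / (12 * (d * √(d : ℝ))) ≤
      t / 2 / ((2 * (d : ℝ) + 2) * (2 : ℝ) ^ ((1 : ℝ) / 3) * √((d : ℝ) - 1)) := by
    rw [div_div]
    refine div_le_div_of_nonneg_left ht0.le (by positivity) (by linarith)
  have hds : 1 ≤ d * √(d : ℝ) := by nlinarith
  have hz1 : t / (12 * (d * √(d : ℝ))) ≤ 1 := by
    rw [div_le_one (by positivity)]
    linarith
  have hrhs := (half_le_arsinh (by positivity) hz1).trans (Real.arsinh_le_arsinh.2 hz)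
  calc _ ≤ 2 * t := by linarith
    _ = 48 * d * √(d : ℝ) * (t / (12 * (d * √(d : ℝ))) / 2) := by
      field_simp
      norm_num
    _ ≤ _ := by gcongr
end
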